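/- With the notation of the tower (H_j, γ_j), assume d_{n−1} ≥ d_{n−2} ≥ … ≥ d_0, and assume there is an integer m with 1 ≤ m ≤ n−1 such that d_{n−m} ≥ 0 > d_{n−m−1}. Then H_n is isomorphic to the cyclic group ℤ/p^m. -/

import Mathlib

/-- A stage of the tower: an abelian group `carrier` together with a map `γ` to `ℤ/pʲ`. -/
structure TowerStep (p : ℕ) (j : ℕ) where
  carrier : Type
  [grp : AddCommGroup carrier]
  γ : carrier →+ ZMod (p ^ j)

attribute [instance] TowerStep.grp

/-- `r_j = min(j, d_{n-j} + 1)`. -/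
def towerR (n : ℕ) (d : ℕ → ℤ) (j : ℕ) : ℤ := min (j : ℤ) (d (n - j) + 1)

/-- The homomorphism `ℤ/p^a → ℤ/p^(a+1)` sending `1` to `p^e` (where `1 ≤ e`). -/
noncomputable def towerPhi (p a e : ℕ) (he : 1 ≤ e) :
    ZMod (p ^ a) →+ ZMod (p ^ (a + 1)) :=
  ZMod.lift (p ^ a) ⟨zmultiplesHom _ ((p : ZMod (p ^ (a + 1))) ^ e), by
    have h0 : (p : ZMod (p ^ (a + 1))) ^ (a + 1) = 0 := by
      have := ZMod.natCast_self (p ^ (a + 1))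
      push_cast at this
      exact this
    simp only [zmultiplesHom_apply, zsmul_eq_mul]
    push_cast
    have key : (p : ZMod (p ^ (a + 1))) ^ a * (p : ZMod (p ^ (a + 1))) ^ e =
        (p : ZMod (p ^ (a + 1))) ^ (a + 1) * (p : ZMod (p ^ (a + 1))) ^ (a + e - (a + 1)) := by
      rw [← pow_add, ← pow_add]
      congr 1
      omega
    rw [key, h0, zero_mul]⟩

/-- The tower `(H_j, γ_j)` of the paper:  `H_1 = ℤ/p` if `d_{n-1} ≥ 0` and `0` otherwise,
and for `j ≥ 2`, if `r_j ≥ 1` then `H_j` is the pullback of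
`R^h_j : ℤ/p^j → ℤ/p^(j-1)` (sending `1 ↦ p^(r_j - 1)`) and `γ_{j-1} : H_{j-1} → ℤ/p^(j-1)`,
with `γ_j (x, y) = x`, while if `r_j < 1` then `H_j = H_{j-1}` and
`γ_j = φ_j ∘ γ_{j-1}` where `φ_j : ℤ/p^(j-1) → ℤ/p^j` sends `1` to `p^(1 - r_j)`. -/
noncomputable def tower (p n : ℕ) (d : ℕ → ℤ) : (j : ℕ) → TowerStep p j
  | 0 => { carrier := PUnit, grp := inferInstance, γ := 0 }
  | 1 =>
    if 0 ≤ d (n - 1) then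
      { carrier := ZMod (p ^ 1), grp := inferInstance, γ := AddMonoidHom.id _ }
    else
      { carrier := PUnit, grp := inferInstance, γ := 0 }
  | (j + 2) =>
    let prev := tower p n d (j + 1)
    let r : ℤ := towerR n d (j + 2)
    if h : 1 ≤ r then
      let Rh : ZMod (p ^ (j + 2)) →+ ZMod (p ^ (j + 1)) :=
        (AddMonoidHom.mulLeft ((p : ZMod (p ^ (j + 1))) ^ (r - 1).toNat)).comp
          (ZMod.castHom (show p ^ (j + 1) ∣ p ^ (j + 2) from pow_dvd_pow p (by omega)) (ZMod (p ^ (j + 1)))).toAddMonoidHom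
      let K : AddSubgroup (ZMod (p ^ (j + 2)) × prev.carrier) :=
        (Rh.comp (AddMonoidHom.fst _ _) - prev.γ.comp (AddMonoidHom.snd _ _)).ker
      { carrier := ↥K, grp := inferInstance,
        γ := (AddMonoidHom.fst _ _).comp K.subtype }
    else
      { carrier := prev.carrier, grp := prev.grp,
        γ := (towerPhi p (j + 1) (1 - r).toNat (by omega)).comp prev.γ }

theorem one_le_towerR {n : ℕ} {d : ℕ → ℤ} {j : ℕ} (hj : 1 ≤ j) (h : 0 ≤ d (n - j)) :
    1 ≤ towerR n d j :=
  le_min (by exact_mod_cast hj) (by omega)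

theorem towerR_lt_one {n : ℕ} {d : ℕ → ℤ} {j : ℕ} (h : d (n - j) < 0) : towerR n d j < 1 :=
  (min_le_right _ _).trans_lt (by omega)

/-- The projection from the pullback of `f` along a bijective `g` is bijective. -/
theorem fst_comp_ker_subtype_bijective {A B C : Type*} [AddCommGroup A] [AddCommGroup B]
    [AddCommGroup C] (f : A →+ C) (g : B →+ C) (hg : Function.Bijective g) :
    Function.Bijective ((AddMonoidHom.fst A B).comp
      (f.comp (AddMonoidHom.fst A B) - g.comp (AddMonoidHom.snd A B)).ker.subtype) := by
  have mem (z : A × B) :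
      z ∈ (f.comp (AddMonoidHom.fst A B) - g.comp (AddMonoidHom.snd A B)).ker ↔ f z.1 = g z.2 := by
    simp [AddMonoidHom.mem_ker, sub_eq_zero]
  constructor
  · rintro ⟨⟨x, y⟩, h⟩ ⟨⟨x', y'⟩, h'⟩ (rfl : x = x')
    obtain rfl : y = y' := hg.1 (((mem _).1 h).symm.trans ((mem _).1 h'))
    rfl
  · intro x
    obtain ⟨y, hy⟩ := hg.2 (f x)
    exact ⟨⟨(x, y), (mem _).2 hy.symm⟩, rfl⟩

/-- As long as the dimensions are nonnegative, the maps `γ_j` are isomorphisms. -/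
theorem tower_γ_bijective (p n : ℕ) (d : ℕ → ℤ) :
    ∀ j, (∀ i, 1 ≤ i → i ≤ j → 0 ≤ d (n - i)) → Function.Bijective (tower p n d j).γ
  | 0, _ => by
    have : Subsingleton (ZMod (p ^ 0)) := by
      rw [pow_zero]
      infer_instance
    exact ⟨fun _ _ _ => rfl, fun x => ⟨PUnit.unit, Subsingleton.elim _ _⟩⟩
  | 1, h => by
    rw [tower, if_pos (h 1 le_rfl le_rfl)]
    exact Function.bijective_id
  | j + 2, h => by
    have ih := tower_γ_bijective p n d (j + 1) fun i hi hij => h i hi (by omega)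
    have hr : 1 ≤ towerR n d (j + 2) := one_le_towerR (by omega) (h (j + 2) (by omega) le_rfl)
    rw [tower]
    dsimp only
    rw [dif_pos hr]
    exact fst_comp_ker_subtype_bijective _ _ ih

/-- A negative dimension does not change the group. -/
theorem tower_succ_carrier_equiv (p n : ℕ) (d : ℕ → ℤ) {j : ℕ} (hj : 1 ≤ j)
    (h : d (n - (j + 1)) < 0) :
    Nonempty ((tower p n d (j + 1)).carrier ≃+ (tower p n d j).carrier) := by
  obtain ⟨j, rfl⟩ := Nat.exists_eq_add_of_le' hj
  have hr : ¬1 ≤ towerR n d (j + 2) := not_le.2 (towerR_lt_one h)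
  rw [tower]
  dsimp only
  rw [dif_neg hr]
  exact ⟨AddEquiv.refl _⟩

/-- Special case `α = q - γ` (the dimensions `d_{n-1} ≥ d_{n-2} ≥ … ≥ d_0` are increasing):
if `d_{n-m} ≥ 0 > d_{n-m-1}` for some `1 ≤ m ≤ n - 1`, then `H_n ≅ ℤ/pᵐ`. -/
theorem tower_cyclic_of_monotone (p n : ℕ) (hp : p.Prime) (hn : 1 ≤ n)
    (d : ℕ → ℤ) (hmono : ∀ i j, i ≤ j → j ≤ n - 1 → d i ≤ d j)
    (m : ℕ) (hm1 : 1 ≤ m) (hmn : m ≤ n - 1)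
    (hpos : 0 ≤ d (n - m)) (hneg : d (n - m - 1) < 0) :
    Nonempty ((tower p n d n).carrier ≃+ ZMod (p ^ m)) := by
  have stable (j : ℕ) (hmj : m ≤ j) : j ≤ n →
      Nonempty ((tower p n d j).carrier ≃+ (tower p n d m).carrier) := by
    induction j, hmj using Nat.le_induction with
    | base => exact fun _ => ⟨AddEquiv.refl _⟩
    | succ j hmj ih =>
      intro hjn
      obtain ⟨e⟩ := ih (by omega)
      obtain ⟨e'⟩ := tower_succ_carrier_equiv p n d (hm1.trans hmj)
        ((hmono _ (n - m - 1) (by omega) (by omega)).trans_lt hneg)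
      exact ⟨e'.trans e⟩
  obtain ⟨e⟩ := stable n (by omega) le_rfl
  exact ⟨e.trans (AddEquiv.ofBijective _ (tower_γ_bijective p n d m fun i hi him =>
    hpos.trans (hmono _ _ (by omega) (by omega))))⟩
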